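/- Let n, r ≥ 0 and 0 ≤ c ≤ min(n,r) be integers, and let A (n×n), B (n×r), C (n×r), D (r×n), E (r×r), F (r×r) be complex matrices. Let G be the r×n matrix with G_{ab} = −δ_{ab} 𝟙[a ≤ c] and H the r×r matrix with H_{ab} = −δ_{ab} 𝟙[a > c]. Then the determinant of the (n+2r)×(n+2r) block matrix [[A, B, C], [D, E, F], [G, H, 0]] equals the determinant of the (n+r)×(n+r) block matrix [[A', B'], [D', E']], where the b-th column of A' is the b-th column of C for b ≤ c and the b-th column of A for b > c; the b-th column of B' is the b-th column of B for b ≤ c and the b-th column of C for b > c; the b-th column of D' is the b-th column of F for b ≤ c and the b-th column of D for b > c; and the b-th column of E' is the b-th column of E for b ≤ c and the b-th column of F for b > c. -/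

import Mathlib

noncomputable section

/-- The `(n+2r)×(n+2r)` block matrix `[[A,B,C],[D,E,F],[G,H,0]]`, with `1`-based
conditions encoded through `0`-based `Fin` indices: `G_{ab} = -δ_{ab}𝟙[a ≤ c]` and
`H_{ab} = -δ_{ab}𝟙[a > c]`. -/
def bigBlock {n r : ℕ} (c : ℕ)
    (A : Matrix (Fin n) (Fin n) ℂ) (B C : Matrix (Fin n) (Fin r) ℂ)
    (D : Matrix (Fin r) (Fin n) ℂ) (E F : Matrix (Fin r) (Fin r) ℂ) :
    Matrix (Fin n ⊕ (Fin r ⊕ Fin r)) (Fin n ⊕ (Fin r ⊕ Fin r)) ℂ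
  | Sum.inl a, Sum.inl b => A a b
  | Sum.inl a, Sum.inr (Sum.inl b) => B a b
  | Sum.inl a, Sum.inr (Sum.inr b) => C a b
  | Sum.inr (Sum.inl a), Sum.inl b => D a b
  | Sum.inr (Sum.inl a), Sum.inr (Sum.inl b) => E a b
  | Sum.inr (Sum.inl a), Sum.inr (Sum.inr b) => F a b
  | Sum.inr (Sum.inr a), Sum.inl b =>
      if (a : ℕ) = (b : ℕ) ∧ (a : ℕ) + 1 ≤ c then -1 else 0
  | Sum.inr (Sum.inr a), Sum.inr (Sum.inl b) =>
      if (a : ℕ) = (b : ℕ) ∧ c < (a : ℕ) + 1 then -1 else 0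
  | Sum.inr (Sum.inr _), Sum.inr (Sum.inr _) => 0

/-- If `P` has a right inverse `Q`, then a column operation followed by a Schur complement
eliminates the last block row of `[[X, Y], [-P, 0]]`. -/
theorem det_fromBlocks_neg_zero_of_mul_eq_one {m k R : Type*} [Fintype m] [DecidableEq m]
    [Fintype k] [DecidableEq k] [CommRing R] (X : Matrix m m R) (Y : Matrix m k R)
    {P : Matrix k m R} {Q : Matrix m k R} (hPQ : P * Q = 1) :
    (Matrix.fromBlocks X Y (-P) 0).det = (X + (Y - X * Q) * P).det := by
  have hdet : (Matrix.fromBlocks 1 (-Q) 0 1 : Matrix (m ⊕ k) (m ⊕ k) R).det = 1 := by simp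
  rw [← mul_one (Matrix.fromBlocks X Y (-P) 0).det, ← hdet, ← Matrix.det_mul,
    Matrix.fromBlocks_multiply]
  simp [hPQ, Matrix.det_fromBlocks_one₂₂, neg_add_eq_sub]

/-- For injective `σ`, bordering `X` by `Y` and the negated selection matrix of `σ` has the same
determinant as replacing, for every `a`, the column `σ a` of `X` by the column `a` of `Y`. -/
theorem det_fromBlocks_neg_selection {m k R : Type*} [Fintype m] [DecidableEq m]
    [Fintype k] [DecidableEq k] [CommRing R] (X Z : Matrix m m R) (Y : Matrix m k R)
    {σ : k → m} (hσ : Function.Injective σ) (hZ : ∀ i a, Z i (σ a) = Y i a)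
    (hX : ∀ i j, j ∉ Set.range σ → Z i j = X i j) :
    (Matrix.fromBlocks X Y (-Matrix.of fun a j => if σ a = j then 1 else 0) 0).det = Z.det := by
  rw [det_fromBlocks_neg_zero_of_mul_eq_one X Y
    (Q := Matrix.of fun j a => if σ a = j then 1 else 0)]
  · congr 1
    ext i j
    by_cases hj : j ∈ Set.range σ
    · obtain ⟨a, rfl⟩ := hj
      simp [Matrix.mul_apply, hσ.eq_iff, hZ]
    · have hne : ∀ a, σ a ≠ j := fun a h => hj ⟨a, h⟩
      simp [Matrix.mul_apply, hne, hX i j hj]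
  · ext a b
    simp [Matrix.mul_apply, Matrix.one_apply, hσ.eq_iff, eq_comm]

/-- the determinant of the `(n+2r)×(n+2r)` block matrix
`[[A,B,C],[D,E,F],[G,H,0]]` equals the determinant of the reduced `(n+r)×(n+r)`
block matrix `[[A',B'],[D',E']]` obtained by the column exchanges described in the text. -/
theorem det_bigBlock_eq_det_reduced (n r c : ℕ) (hcn : c ≤ n) (hcr : c ≤ r)
    (A : Matrix (Fin n) (Fin n) ℂ) (B C : Matrix (Fin n) (Fin r) ℂ)
    (D : Matrix (Fin r) (Fin n) ℂ) (E F : Matrix (Fin r) (Fin r) ℂ) :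
    (bigBlock c A B C D E F).det =
      Matrix.det (Matrix.fromBlocks
        -- A' : the b-th column is that of C for b ≤ c and that of A for b > c
        (fun (a b : Fin n) =>
          if hb : (b : ℕ) + 1 ≤ c then C a ⟨(b : ℕ), lt_of_lt_of_le (Nat.lt_of_succ_le hb) hcr⟩
          else A a b)
        -- B' : the b-th column is that of B for b ≤ c and that of C for b > c
        (fun (a : Fin n) (b : Fin r) => if (b : ℕ) + 1 ≤ c then B a b else C a b)
        -- D' : the b-th column is that of F for b ≤ c and that of D for b > c
        (fun (a : Fin r) (b : Fin n) =>
          if hb : (b : ℕ) + 1 ≤ c then F a ⟨(b : ℕ), lt_of_lt_of_le (Nat.lt_of_succ_le hb) hcr⟩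
          else D a b)
        -- E' : the b-th column is that of E for b ≤ c and that of F for b > c
        (fun (a b : Fin r) => if (b : ℕ) + 1 ≤ c then E a b else F a b)) := by
  let σ : Fin r → Fin n ⊕ Fin r := fun a =>
    if h : (a : ℕ) < c then Sum.inl ⟨a, h.trans_le hcn⟩ else Sum.inr a
  have hσl : ∀ a b, σ a = Sum.inl b ↔ (a : ℕ) = (b : ℕ) ∧ (a : ℕ) + 1 ≤ c := by
    intro a b
    by_cases h : (a : ℕ) < c <;> simp [σ, h, Fin.ext_iff]
  have hσr : ∀ a b, σ a = Sum.inr b ↔ (a : ℕ) = (b : ℕ) ∧ c < (a : ℕ) + 1 := by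
    intro a b
    by_cases h : (a : ℕ) < c <;> simp [σ, h, Fin.ext_iff, ← not_lt]
  have hσ : Function.Injective σ := by
    intro a b hab
    rcases hb : σ b with j | j
    · rw [hb, hσl] at hab
      rw [hσl] at hb
      exact Fin.ext (hab.1.trans hb.1.symm)
    · rw [hb, hσr] at hab
      rw [hσr] at hb
      exact Fin.ext (hab.1.trans hb.1.symm)
  rw [← Matrix.det_submatrix_equiv_self (Equiv.sumAssoc (Fin n) (Fin r) (Fin r)),
    ← det_fromBlocks_neg_selection (Matrix.fromBlocks A B D E) _
      (Matrix.fromRows C F) hσ]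
  · congr 1
    ext ((i | i) | i) ((j | j) | j) <;> simp [bigBlock, hσl, hσr, neg_ite]
  · intro i a
    by_cases h : (a : ℕ) < c <;> rcases i with i | i <;> simp [σ, h, Matrix.fromBlocks]
  · rintro i (j | j) hj
    · have h : ¬ (j : ℕ) < c := fun h =>
        hj ⟨⟨j, h.trans_le hcr⟩, (hσl _ _).2 ⟨rfl, h⟩⟩
      rcases i with i | i <;> simp [h, Matrix.fromBlocks]
    · have h : (j : ℕ) < c := Nat.succ_le_iff.mp <| not_lt.mp fun h => hj ⟨j, (hσr _ _).2 ⟨rfl, h⟩⟩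
      rcases i with i | i <;> simp [h, Matrix.fromBlocks]

end
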